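/- arXiv:2112.10376 — 2 statements merged into one kernel-verified Lean document; each statement's English description precedes it below -/
import Mathlib

section
/- There exists a constant C > 0 such that the following holds. For every finite linearly ordered alphabet Σ of size σ ≥ 2, every integer ℓ ≥ 1, and every integer n > ℓ, if T is a string drawn uniformly at random from Σ^n (i.e., generated by a memoryless source with identical letter probabilities), then the expected size of its order-ℓ bd-anchor set satisfies E[|A_ℓ(T)|] ≤ C·( n·log ℓ/(ℓ·log σ) + n/ℓ ). -/
open scoped Classical

variable {α : Type*} [LinearOrder α]

/-- The rotation of `W` starting at the 1-based position `j`. -/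
def rot (W : List α) (j : ℕ) : List α := W.drop (j - 1) ++ W.take (j - 1)

/-- The fragment `T[i..i+ℓ-1]` (1-based position `i`, length `ℓ`). -/
def frag (T : List α) (i ℓ : ℕ) : List α := (T.drop (i - 1)).take ℓ

/-- The `m`-fold concatenation `U^m`. -/
def listPow (U : List α) (m : ℕ) : List α := (List.replicate m U).flatten

/-- A nonempty string is primitive if it is not a power `U^m` with `m ≥ 2`. -/
def Primitive (X : List α) : Prop :=
  X ≠ [] ∧ ∀ (U : List α) (m : ℕ), 2 ≤ m → X ≠ listPow U m

/-- `j ∈ [1,|X|]` is a position at which a lexicographically minimal rotation of `X` starts. -/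
def IsMinRotPos (X : List α) (j : ℕ) : Prop :=
  j ∈ Finset.Icc 1 X.length ∧ ∀ k ∈ Finset.Icc 1 X.length, rot X j ≤ rot X k

/-- `j` is the bd-anchor of `X`: the smallest position of a lexicographically minimal rotation. -/
def IsBdAnchor (X : List α) (j : ℕ) : Prop :=
  IsMinRotPos X j ∧ ∀ k, IsMinRotPos X k → j ≤ k

/-- The set `A_ℓ(T)` of order-`ℓ` bd-anchors of `T` (1-based absolute positions). -/
def bdAnchors (ℓ : ℕ) (T : List α) : Set ℕ :=
  { p | ∃ i ∈ Finset.Icc 1 (T.length - ℓ + 1), ∃ j, IsBdAnchor (frag T i ℓ) j ∧ p = i - 1 + j }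


theorem card_filter_comp_injective {ι κ γ : Type*} [DecidableEq ι] [DecidableEq κ]
    [Fintype ι] [Fintype κ] [Fintype γ]
    (e : ι → κ) (he : Function.Injective e) (P : (ι → γ) → Prop) :
    (Finset.univ.filter fun f : κ → γ => P (f ∘ e)).card * Fintype.card γ ^ Fintype.card ι =
      Fintype.card γ ^ Fintype.card κ * (Finset.univ.filter fun g : ι → γ => P g).card := by
  let c := {x : κ // x ∉ Set.range e}
  let φ : ι ⊕ c ≃ κ :=
    (Equiv.sumCongr (Equiv.ofInjective e he) (Equiv.refl c)).trans
      (Equiv.sumCompl (fun x => x ∈ Set.range e))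
  let ψ : (κ → γ) ≃ (ι → γ) × (c → γ) :=
    (Equiv.arrowCongr φ.symm (Equiv.refl γ)).trans (Equiv.sumArrowEquivProdArrow ι c γ)
  have hψ : ∀ f, (ψ f).1 = f ∘ e := by
    intro f
    ext i
    simp [ψ, φ, Equiv.sumArrowEquivProdArrow, Equiv.arrowCongr, Equiv.sumCompl]
  have hcard : Fintype.card κ = Fintype.card ι + Fintype.card c := by
    rw [← Fintype.card_sum, Fintype.card_congr φ]
  have hfil : (Finset.univ.filter fun f : κ → γ => P (f ∘ e)).card =
      ((Finset.univ.filter fun g : ι → γ => P g) ×ˢ (Finset.univ : Finset (c → γ))).card := by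
    refine Finset.card_equiv ψ fun f => ?_
    simp [hψ]
  rw [hfil, Finset.card_product, Finset.card_univ, Fintype.card_fun, hcard, pow_add]
  ring

theorem pow_succ_add_mul_pow_le (s m : ℕ) :
    s ^ (m + 1) + (m + 1) * s ^ m ≤ (s + 1) ^ (m + 1) := by
  induction m with
  | zero => simp
  | succ m ih =>
    calc s ^ (m + 1 + 1) + (m + 1 + 1) * s ^ (m + 1)
        ≤ (s ^ (m + 1) + (m + 1) * s ^ m) * (s + 1) := by
          have : 0 ≤ (m + 1) * s ^ m := Nat.zero_le _
          ring_nf at this ⊢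
          omega
      _ ≤ (s + 1) ^ (m + 1) * (s + 1) := Nat.mul_le_mul_right _ ih
      _ = _ := (pow_succ _ _).symm

theorem sum_card_filter_ge_pow_le {γ : Type*} [LinearOrder γ] (m : ℕ) (S : Finset γ) :
    (m + 1) * ∑ u ∈ S, (S.filter fun v => u ≤ v).card ^ m ≤
      S.card ^ (m + 1) + (m + 1) * S.card ^ m := by
  induction S using Finset.induction_on_min with
  | empty => simp
  | insert a S ha ih =>
    have hmem : a ∉ S := fun h => lt_irrefl _ (ha a h)
    rw [Finset.sum_insert hmem, Finset.card_insert_of_notMem hmem]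
    have h1 : (insert a S).filter (fun v => a ≤ v) = insert a S := by
      refine Finset.filter_true_of_mem fun x hx => ?_
      rcases Finset.mem_insert.1 hx with rfl | hx
      · exact le_rfl
      · exact (ha x hx).le
    have h2 : ∀ u ∈ S, ((insert a S).filter fun v => u ≤ v).card ^ m =
        (S.filter fun v => u ≤ v).card ^ m := by
      intro u hu
      rw [Finset.filter_insert, if_neg (not_le.2 (ha u hu))]
    rw [Finset.sum_congr rfl h2, h1, Finset.card_insert_of_notMem hmem, mul_add]
    have := pow_succ_add_mul_pow_le S.card m
    omega

theorem card_filter_forall_zero_le {γ : Type*} [LinearOrder γ] [Fintype γ] (m : ℕ) :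
    (m + 1) * (Finset.univ.filter fun g : Fin (m + 1) → γ => ∀ s, g 0 ≤ g s).card ≤
      Fintype.card γ ^ (m + 1) + (m + 1) * Fintype.card γ ^ m := by
  have h := sum_card_filter_ge_pow_le m (Finset.univ : Finset γ)
  rw [Finset.card_univ] at h
  convert h using 2
  rw [Finset.card_eq_sum_card_fiberwise (f := fun g : Fin (m + 1) → γ => g 0)
    (t := Finset.univ) (fun _ _ => Finset.mem_coe.2 (Finset.mem_univ _))]
  refine Finset.sum_congr rfl fun u _ => ?_
  have : (Finset.univ.filter fun v : γ => u ≤ v).card ^ m =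
      (Fintype.piFinset fun _ : Fin m => Finset.univ.filter fun v : γ => u ≤ v).card := by
    simp
  rw [this]
  refine Finset.card_bij' (fun g _ => Fin.tail g) (fun h _ => Fin.cons u h) ?_ ?_ ?_ ?_
  · intro g hg
    simp only [Finset.mem_filter, Finset.mem_univ, true_and] at hg
    simp only [Fintype.mem_piFinset, Finset.mem_filter, Finset.mem_univ, true_and]
    intro s
    rw [← hg.2]
    exact hg.1 _
  · intro h hh
    simp only [Fintype.mem_piFinset, Finset.mem_filter, Finset.mem_univ, true_and] at hh
    simp only [Finset.mem_filter, Finset.mem_univ, true_and, Fin.cons_zero, and_true]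
    intro s
    refine Fin.cases ?_ ?_ s
    · simp
    · intro i
      simpa using hh i
  · intro g hg
    simp only [Finset.mem_filter, Finset.mem_univ, true_and] at hg
    rw [← hg.2]
    exact Fin.cons_self_tail g
  · intro h _
    simp

theorem rot_eq_rotate {γ : Type*} (W : List γ) {j : ℕ} (hj : j ∈ Finset.Icc 1 W.length) :
    rot W j = W.rotate (j - 1) := by
  rw [Finset.mem_Icc] at hj
  rw [rot, List.rotate_eq_drop_append_take (by omega)]

theorem isMinRotPos_iff (X : List α) (j : ℕ) :
    IsMinRotPos X j ↔ j ∈ Finset.Icc 1 X.length ∧ ∀ r, X.rotate (j - 1) ≤ X.rotate r := by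
  refine and_congr_right fun hj => ⟨fun h r => ?_, fun h k hk => ?_⟩
  · have hl := Finset.mem_Icc.1 hj
    have hr : r % X.length < X.length := Nat.mod_lt _ (by omega)
    have hk : r % X.length + 1 ∈ Finset.Icc 1 X.length := Finset.mem_Icc.2 (by omega)
    have := h _ hk
    rwa [rot_eq_rotate _ hj, rot_eq_rotate _ hk, Nat.add_sub_cancel, List.rotate_mod] at this
  · rw [rot_eq_rotate _ hj, rot_eq_rotate _ hk]
    exact h _

theorem IsBdAnchor.unique {X : List α} {i j : ℕ} (hi : IsBdAnchor X i) (hj : IsBdAnchor X j) :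
    i = j :=
  le_antisymm (hi.2 _ hj.1) (hj.2 _ hi.1)

theorem IsBdAnchor.rotate {X : List α} {j s : ℕ} (h : IsBdAnchor X j) (hs : s < j) :
    IsBdAnchor (X.rotate s) (j - s) := by
  have hj := (isMinRotPos_iff X j).1 h.1
  have hl := Finset.mem_Icc.1 hj.1
  refine ⟨(isMinRotPos_iff _ _).2 ⟨?_, fun r => ?_⟩, fun k hk => ?_⟩
  · rw [List.length_rotate, Finset.mem_Icc]
    omega
  · rw [List.rotate_rotate, List.rotate_rotate, show s + (j - s - 1) = j - 1 by omega]
    exact hj.2 _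
  · rw [isMinRotPos_iff, List.length_rotate, Finset.mem_Icc] at hk
    by_contra! hlt
    have hmin : IsMinRotPos X (s + k) := by
      refine (isMinRotPos_iff _ _).2 ⟨Finset.mem_Icc.2 (by omega), fun r => ?_⟩
      have := hk.2 (r + (X.length - 1) * s)
      rw [List.rotate_rotate, List.rotate_rotate, ← Nat.add_sub_assoc hk.1.1,
        show s + (r + (X.length - 1) * s) = r + X.length * s by
          obtain ⟨t, ht⟩ : ∃ t, X.length = t + 1 := ⟨X.length - 1, by omega⟩
          rw [ht, Nat.add_sub_cancel]
          ring,
        ← List.rotate_mod _ (r + _), Nat.add_mul_mod_self_left, List.rotate_mod] at this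
      exact this
    have := h.2 _ hmin
    omega

theorem mul_card_filter_isBdAnchor_le [Fintype α] (ℓ j : ℕ) :
    j * (Finset.univ.filter fun X : Fin ℓ → α => IsBdAnchor (List.ofFn X) j).card ≤
      Fintype.card α ^ ℓ := by
  let rotFun : ℕ → (Fin ℓ → α) → Fin ℓ → α := fun s X i =>
    ((List.ofFn X).rotate s)[(i : ℕ)]'(by simp)
  have hrot : ∀ s X, List.ofFn (rotFun s X) = (List.ofFn X).rotate s := by
    intro s X
    apply List.ext_getElem <;> simp [rotFun]
  calc _ = (Finset.range j ×ˢ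
        Finset.univ.filter fun X : Fin ℓ → α => IsBdAnchor (List.ofFn X) j).card := by
        rw [Finset.card_product, Finset.card_range]
    _ ≤ (Finset.univ : Finset (Fin ℓ → α)).card := by
        refine Finset.card_le_card_of_injOn (fun x => rotFun x.1 x.2)
          (fun _ _ => Finset.mem_coe.2 (Finset.mem_univ _)) ?_
        rintro ⟨s, X⟩ hX ⟨t, Y⟩ hY hXY
        simp only [Finset.coe_product, Set.mem_prod, Finset.mem_coe, Finset.mem_range,
          Finset.mem_filter, Finset.mem_univ, true_and] at hX hY hXY
        have hl : (List.ofFn X).rotate s = (List.ofFn Y).rotate t := by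
          rw [← hrot, ← hrot, hXY]
        have h1 := hX.2.rotate hX.1
        have h2 := hY.2.rotate hY.1
        rw [hl] at h1
        have h3 := h1.unique h2
        obtain rfl : s = t := by omega
        rw [List.rotate_eq_rotate] at hl
        rw [List.ofFn_injective hl]
    _ = _ := by simp

theorem frag_ofFn {γ : Type*} {n q k : ℕ} (f : Fin n → γ) (h : q - 1 + k ≤ n) :
    frag (List.ofFn f) q k = List.ofFn fun i : Fin k => f ⟨q - 1 + i, by omega⟩ := by
  apply List.ext_getElem
  · simp [frag]
    omega
  · intros
    simp [frag]

theorem List.take_le_take_of_le {k : ℕ} {a b : List α} (h : a ≤ b) : a.take k ≤ b.take k := by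
  contrapose! h
  induction k generalizing a b with
  | zero => simp at h
  | succ k ih =>
    cases a with
    | nil => simp at h
    | cons x a =>
      cases b with
      | nil => simp
      | cons y b =>
        rw [List.take_succ_cons, List.take_succ_cons, List.cons_lt_cons_iff] at h
        rw [List.cons_lt_cons_iff]
        exact h.imp_right fun h => ⟨h.1, ih h.2⟩

theorem frag_le_frag_of_isMinRotPos {T : List α} {i ℓ j k q : ℕ} (hT : i - 1 + ℓ ≤ T.length)
    (hi : 1 ≤ i) (h : IsMinRotPos (frag T i ℓ) j) (hjk : j + k ≤ ℓ) (hq : i ≤ q)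
    (hqk : q + k ≤ i + ℓ) : frag T (i - 1 + j) k ≤ frag T q k := by
  have hlen : (frag T i ℓ).length = ℓ := by
    simp [frag]
    omega
  have key : ∀ r, 1 ≤ r → r - 1 + k ≤ ℓ → (rot (frag T i ℓ) r).take k = frag T (i - 1 + r) k := by
    intro r hr hrk
    rw [rot, List.take_append_of_le_length (by rw [List.length_drop]; omega), frag, frag,
      List.drop_take, List.take_take, List.drop_drop]
    congr 2 <;> omega
  have hj := Finset.mem_Icc.1 h.1
  by_cases hk : k = 0
  · simp [hk, frag]
  have := List.take_le_take_of_le (k := k)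
    (h.2 (q - i + 1) (Finset.mem_Icc.2 (by omega)))
  rw [key _ (by omega) (by omega), key _ (by omega) (by omega)] at this
  rwa [show i - 1 + (q - i + 1) = q by omega] at this

theorem mul_card_filter_isBdAnchor_frag_le [Fintype α] {n i ℓ : ℕ} (hin : i - 1 + ℓ ≤ n) (j : ℕ)
    (hα : 0 < Fintype.card α) :
    j * (Finset.univ.filter fun f : Fin n → α => IsBdAnchor (frag (List.ofFn f) i ℓ) j).card ≤
      Fintype.card α ^ n := by
  have h := card_filter_comp_injective (γ := α) (fun x : Fin ℓ => (⟨i - 1 + x, by omega⟩ : Fin n))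
    (fun x y hxy => by simpa [Fin.ext_iff] using hxy) (fun g => IsBdAnchor (List.ofFn g) j)
  simp only [Fintype.card_fin] at h
  simp only [frag_ofFn _ hin]
  refine Nat.le_of_mul_le_mul_right ?_ (pow_pos hα ℓ)
  calc _ = j * ((Finset.univ.filter fun f : Fin n → α => IsBdAnchor
          (List.ofFn fun x : Fin ℓ => f ⟨i - 1 + x, by omega⟩) j).card *
          Fintype.card α ^ ℓ) := by ring
    _ = j * (Fintype.card α ^ n *
          (Finset.univ.filter fun g : Fin ℓ → α => IsBdAnchor (List.ofFn g) j).card) :=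
        congrArg (j * ·) h
    _ = Fintype.card α ^ n * (j *
          (Finset.univ.filter fun g : Fin ℓ → α => IsBdAnchor (List.ofFn g) j).card) := by ring
    _ ≤ _ := Nat.mul_le_mul_left _ (mul_card_filter_isBdAnchor_le ℓ j)

theorem mul_card_filter_frag_le_frag [Fintype α] {n m k : ℕ} (q : ℕ → ℕ)
    (hq : ∀ s ≤ m, q s - 1 + k ≤ n) (hα : 0 < Fintype.card α)
    (hinj : ∀ s ≤ m, ∀ t ≤ m, ∀ x < k, ∀ y < k, q s - 1 + x = q t - 1 + y → s = t) :
    (m + 1) * (Finset.univ.filter fun f : Fin n → α =>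
        ∀ s ≤ m, frag (List.ofFn f) (q 0) k ≤ frag (List.ofFn f) (q s) k).card *
        Fintype.card α ^ k ≤
      Fintype.card α ^ n * (Fintype.card α ^ k + (m + 1)) := by
  let e : Fin (m + 1) × Fin k → Fin n := fun x =>
    ⟨q x.1 - 1 + x.2, by have := hq x.1 (by omega); omega⟩
  have he : Function.Injective e := by
    rintro ⟨s, x⟩ ⟨t, y⟩ h
    have h' : q s - 1 + x = q t - 1 + y := by simpa [e] using h
    obtain rfl : s = t := Fin.ext (hinj s (by omega) t (by omega) x x.2 y y.2 h')
    have : x = y := Fin.ext (by omega)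
    rw [this]
  let P : (Fin (m + 1) → Fin k → α) → Prop := fun g => ∀ s, List.ofFn (g 0) ≤ List.ofFn (g s)
  have h := card_filter_comp_injective (γ := α) e he (fun g => P (Function.curry g))
  have hcurry : (Finset.univ.filter fun g : Fin (m + 1) × Fin k → α => P (Function.curry g)).card =
      (Finset.univ.filter P).card := by
    refine Finset.card_equiv (Equiv.curry _ _ _) fun g => ?_
    simp [Equiv.curry]
  have hP : (m + 1) * (Finset.univ.filter P).card ≤
      (Fintype.card α ^ k) ^ (m + 1) + (m + 1) * (Fintype.card α ^ k) ^ m := by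
    let _ : LinearOrder (Fin k → α) := LinearOrder.lift' List.ofFn List.ofFn_injective
    have := card_filter_forall_zero_le (γ := Fin k → α) m
    rw [Fintype.card_fun, Fintype.card_fin] at this
    exact this
  have hset : (Finset.univ.filter fun f : Fin n → α =>
        ∀ s ≤ m, frag (List.ofFn f) (q 0) k ≤ frag (List.ofFn f) (q s) k) =
      Finset.univ.filter fun f : Fin n → α => P (Function.curry (f ∘ e)) := by
    refine Finset.filter_congr fun f _ => ⟨fun hf s => ?_, fun hf s hs => ?_⟩
    · have := hf s (by omega)
      rwa [frag_ofFn _ (hq 0 (by omega)), frag_ofFn _ (hq s (by omega))] at this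
    · rw [frag_ofFn _ (hq 0 (by omega)), frag_ofFn _ (hq s (by omega))]
      exact hf ⟨s, by omega⟩
  replace h : (Finset.univ.filter fun f : Fin n → α => P (Function.curry (f ∘ e))).card *
      Fintype.card α ^ Fintype.card (Fin (m + 1) × Fin k) =
        Fintype.card α ^ Fintype.card (Fin n) * (Finset.univ.filter P).card := by
    rw [← hcurry]
    convert h
  rw [hset]
  rw [Fintype.card_prod, Fintype.card_fin, Fintype.card_fin, Fintype.card_fin,
    mul_comm (m + 1) k, pow_mul] at h
  generalize (Finset.univ.filter fun f : Fin n → α => P (Function.curry (f ∘ e))).card = F at h ⊢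
  generalize (Finset.univ.filter P).card = G at h hP
  have hN : 0 < Fintype.card α ^ k := pow_pos hα k
  generalize Fintype.card α ^ k = N at h hP hN ⊢
  refine Nat.le_of_mul_le_mul_right ?_ (pow_pos hN m)
  calc (m + 1) * F * N * N ^ m = (m + 1) * (F * N ^ (m + 1)) := by ring
    _ = Fintype.card α ^ n * ((m + 1) * G) := by rw [h]; ring
    _ ≤ Fintype.card α ^ n * (N ^ (m + 1) + (m + 1) * N ^ m) := Nat.mul_le_mul_left _ hP
    _ = _ := by ring

theorem mul_le_of_mul_le {ℓ k m F N A : ℕ} (hk : 1 ≤ k) (hN : ℓ ≤ N) (hN0 : 0 < N)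
    (hm : ℓ ≤ 4 * k * (m + 1)) (h : (m + 1) * F * N ≤ A * (N + (m + 1))) :
    ℓ * F ≤ 5 * k * A := by
  refine Nat.le_of_mul_le_mul_right ?_ (Nat.mul_pos (show 0 < m + 1 by omega) hN0)
  calc ℓ * F * ((m + 1) * N) = ℓ * ((m + 1) * F * N) := by ring
    _ ≤ ℓ * (A * (N + (m + 1))) := Nat.mul_le_mul_left _ h
    _ = A * (ℓ * N + ℓ * (m + 1)) := by ring
    _ ≤ A * (4 * k * (m + 1) * N + k * N * (m + 1)) := by
        gcongr
        nlinarith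
    _ = _ := by ring

theorem mul_card_filter_mem_bdAnchors_le [Fintype α] {n ℓ k : ℕ} (p : ℕ) (hk : 1 ≤ k)
    (hkℓ : 4 * k ≤ ℓ) (hℓ : ℓ ≤ Fintype.card α ^ k) (hn : ℓ < n) :
    ℓ * (Finset.univ.filter fun f : Fin n → α => p ∈ bdAnchors ℓ (List.ofFn f)).card ≤
      12 * k * Fintype.card α ^ n := by
  have hN0 : 0 < Fintype.card α ^ k := by omega
  have hα : 0 < Fintype.card α := by
    by_contra h0
    rw [Nat.eq_zero_of_not_pos h0, zero_pow (by omega)] at hN0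
    omega
  obtain ⟨m, hm1, hm2⟩ : ∃ m, 4 * (m * k) ≤ ℓ ∧ ℓ ≤ 4 * k * (m + 1) := by
    refine ⟨ℓ / (4 * k), ?_, (Nat.lt_mul_div_succ ℓ (by omega)).le⟩
    calc 4 * (ℓ / (4 * k) * k) = 4 * k * (ℓ / (4 * k)) := by ring
      _ ≤ ℓ := Nat.mul_div_le _ _
  let L := Finset.univ.filter fun f : Fin n → α => (m * k + 1 ≤ p ∧ p - 1 + k ≤ n) ∧
    ∀ s ≤ m, frag (List.ofFn f) (p - 0 * k) k ≤ frag (List.ofFn f) (p - s * k) k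
  let R := Finset.univ.filter fun f : Fin n → α => (1 ≤ p ∧ p + m * k - 1 + k ≤ n) ∧
    ∀ s ≤ m, frag (List.ofFn f) (p + 0 * k) k ≤ frag (List.ofFn f) (p + s * k) k
  let S := fun t => Finset.univ.filter fun f : Fin n → α =>
    ∃ i, (1 ≤ i ∧ i - 1 + ℓ ≤ n ∧ i - 1 + (ℓ - t) = p) ∧
      IsBdAnchor (frag (List.ofFn f) i ℓ) (ℓ - t)
  have hsk : ∀ s ≤ m, s * k ≤ m * k := fun s hs => Nat.mul_le_mul_right k hs
  have hdisj : ∀ s t x y, x < k → y < k → s * k + x = t * k + y → s = t := by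
    intro s t x y hx hy h
    have h1 : (x + k * s) / k = (y + k * t) / k := by
      congr 1
      linarith [mul_comm s k, mul_comm t k]
    rwa [Nat.add_mul_div_left _ _ (by omega), Nat.add_mul_div_left _ _ (by omega),
      Nat.div_eq_of_lt hx, Nat.div_eq_of_lt hy, zero_add, zero_add] at h1
  have hL : ℓ * L.card ≤ 5 * k * Fintype.card α ^ n := by
    by_cases hc : m * k + 1 ≤ p ∧ p - 1 + k ≤ n
    · refine mul_le_of_mul_le hk hℓ hN0 hm2 ?_
      simp only [L, hc, true_and, and_self]
      refine mul_card_filter_frag_le_frag (fun s => p - s * k) (fun s hs => ?_) hα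
        fun s hs t ht x hx y hy h => ?_
      · omega
      · have := hsk s hs
        have := hsk t ht
        exact (hdisj t s x y hx hy (by omega)).symm
    · have : L = ∅ := Finset.filter_false_of_mem fun f _ hf => hc hf.1
      simp [this]
  have hR : ℓ * R.card ≤ 5 * k * Fintype.card α ^ n := by
    by_cases hc : 1 ≤ p ∧ p + m * k - 1 + k ≤ n
    · refine mul_le_of_mul_le hk hℓ hN0 hm2 ?_
      simp only [R, hc, true_and, and_self]
      refine mul_card_filter_frag_le_frag (fun s => p + s * k) (fun s hs => ?_) hα
        fun s hs t ht x hx y hy h => ?_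
      · have := hsk s hs
        omega
      · exact hdisj s t x y hx hy (by omega)
    · have : R = ∅ := Finset.filter_false_of_mem fun f _ hf => hc hf.1
      simp [this]
  have hS : ∀ t < k, ℓ * (S t).card ≤ 2 * Fintype.card α ^ n := by
    intro t ht
    by_cases hc : ∃ i, 1 ≤ i ∧ i - 1 + ℓ ≤ n ∧ i - 1 + (ℓ - t) = p
    · obtain ⟨i, hi⟩ := hc
      have h1 := mul_card_filter_isBdAnchor_frag_le (α := α) hi.2.1 (ℓ - t) hα
      have h2 : S t ⊆ Finset.univ.filter fun f : Fin n → α =>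
          IsBdAnchor (frag (List.ofFn f) i ℓ) (ℓ - t) := by
        refine Finset.monotone_filter_right _ fun f _ hf => ?_
        obtain ⟨i', hi', hf⟩ := hf
        obtain rfl : i = i' := by omega
        exact hf
      have h3 := Finset.card_le_card h2
      calc ℓ * (S t).card ≤ (2 * (ℓ - t)) * _ := Nat.mul_le_mul (by omega) h3
        _ = 2 * ((ℓ - t) * _) := mul_assoc _ _ _
        _ ≤ _ := Nat.mul_le_mul_left _ h1
    · have : S t = ∅ := by
        refine Finset.filter_false_of_mem fun f _ hf => hc ?_
        obtain ⟨i, hi, _⟩ := hf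
        exact ⟨i, hi⟩
      simp [this]
  have hsub : (Finset.univ.filter fun f : Fin n → α => p ∈ bdAnchors ℓ (List.ofFn f)) ⊆
      (L ∪ R) ∪ (Finset.range k).biUnion S := by
    intro f hf
    obtain ⟨i, hi, j, hj, hp⟩ := (Finset.mem_filter.1 hf).2
    rw [List.length_ofFn, Finset.mem_Icc] at hi
    have hT : i - 1 + ℓ ≤ (List.ofFn f).length := by rw [List.length_ofFn]; omega
    have hj' := Finset.mem_Icc.1 hj.1.1
    have hlen : (frag (List.ofFn f) i ℓ).length = ℓ := by
      simp [frag]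
      omega
    rw [hlen] at hj'
    by_cases hjk : j + k ≤ ℓ
    · have hmin := fun q => frag_le_frag_of_isMinRotPos (q := q) hT hi.1 hj.1 hjk
      rw [← hp] at hmin
      refine Finset.mem_union_left _ (Finset.mem_union.2 ?_)
      by_cases hside : i + m * k ≤ p
      · refine Or.inl (Finset.mem_filter.2 ⟨Finset.mem_univ _, by omega, fun s hs => ?_⟩)
        have := hsk s hs
        rw [zero_mul, Nat.sub_zero]
        exact hmin _ (by omega) (by omega)
      · refine Or.inr (Finset.mem_filter.2 ⟨Finset.mem_univ _, by omega, fun s hs => ?_⟩)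
        have := hsk s hs
        rw [zero_mul, Nat.add_zero]
        exact hmin _ (by omega) (by omega)
    · refine Finset.mem_union_right _ (Finset.mem_biUnion.2 ⟨ℓ - j, by simp; omega, ?_⟩)
      refine Finset.mem_filter.2 ⟨Finset.mem_univ _, i, by omega, ?_⟩
      rwa [show ℓ - (ℓ - j) = j by omega]
  calc _ ≤ ℓ * ((L.card + R.card) + ∑ t ∈ Finset.range k, (S t).card) := by
        refine Nat.mul_le_mul_left _ ((Finset.card_le_card hsub).trans ?_)
        refine (Finset.card_union_le _ _).trans ?_
        exact Nat.add_le_add (Finset.card_union_le _ _) Finset.card_biUnion_le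
    _ = ℓ * L.card + ℓ * R.card + ∑ t ∈ Finset.range k, ℓ * (S t).card := by
        rw [mul_add, mul_add, Finset.mul_sum]
    _ ≤ 5 * k * Fintype.card α ^ n + 5 * k * Fintype.card α ^ n +
          ∑ _t ∈ Finset.range k, 2 * Fintype.card α ^ n :=
        Nat.add_le_add (Nat.add_le_add hL hR)
          (Finset.sum_le_sum fun t ht => hS t (Finset.mem_range.1 ht))
    _ = _ := by
        rw [Finset.sum_const, Finset.card_range, smul_eq_mul]
        ring

theorem bdAnchors_subset_Icc {ℓ : ℕ} {T : List α} (hℓ : ℓ ≤ T.length) :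
    bdAnchors ℓ T ⊆ Finset.Icc 1 T.length := by
  rintro p ⟨i, hi, j, hj, rfl⟩
  have hj' := Finset.mem_Icc.1 hj.1.1
  rw [Finset.mem_Icc] at hi
  have hlen : (frag T i ℓ).length ≤ ℓ := by simp [frag]
  rw [Finset.mem_coe, Finset.mem_Icc]
  omega

theorem mul_sum_ncard_bdAnchors_le [Fintype α] {n ℓ k : ℕ} (hk : 1 ≤ k)
    (hℓ : ℓ ≤ Fintype.card α ^ k) (hn : ℓ < n) :
    ℓ * ∑ f : Fin n → α, (bdAnchors ℓ (List.ofFn f)).ncard ≤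
      12 * k * n * Fintype.card α ^ n := by
  have hcard : ∀ f : Fin n → α, (bdAnchors ℓ (List.ofFn f)).ncard =
      ((Finset.Icc 1 n).filter fun p => p ∈ bdAnchors ℓ (List.ofFn f)).card := by
    intro f
    have hsub := bdAnchors_subset_Icc (T := List.ofFn f) (ℓ := ℓ) (by simpa using hn.le)
    rw [List.length_ofFn] at hsub
    rw [← Set.ncard_coe_finset]
    congr 1
    ext p
    simpa using fun h => Finset.mem_Icc.1 (hsub h)
  have hswap : ∑ f : Fin n → α, (bdAnchors ℓ (List.ofFn f)).ncard = ∑ p ∈ Finset.Icc 1 n,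
      (Finset.univ.filter fun f : Fin n → α => p ∈ bdAnchors ℓ (List.ofFn f)).card := by
    rw [Finset.sum_congr rfl fun f _ => hcard f]
    exact Finset.sum_card_bipartiteAbove_eq_sum_card_bipartiteBelow
      fun (f : Fin n → α) p => p ∈ bdAnchors ℓ (List.ofFn f)
  rw [hswap, Finset.mul_sum]
  calc _ ≤ ∑ _p ∈ Finset.Icc 1 n, 12 * k * Fintype.card α ^ n := by
        refine Finset.sum_le_sum fun p _ => ?_
        by_cases hkℓ : 4 * k ≤ ℓ
        · exact mul_card_filter_mem_bdAnchors_le p hk hkℓ hℓ hn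
        · refine Nat.mul_le_mul (by omega) ((Finset.card_le_univ _).trans ?_)
          rw [Fintype.card_fun, Fintype.card_fin]
    _ = _ := by
        rw [Finset.sum_const, Nat.card_Icc, smul_eq_mul, Nat.add_sub_cancel]
        ring

theorem Nat.clog_le_log_div_log_add_one {b x : ℕ} (hb : 2 ≤ b) :
    (Nat.clog b x : ℝ) ≤ Real.log x / Real.log b + 1 := by
  have hlog : 0 < Real.log b := Real.log_pos (by exact_mod_cast hb)
  rcases Nat.eq_zero_or_pos (Nat.clog b x) with h0 | h0
  · rw [h0, Nat.cast_zero]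
    have := Real.log_natCast_nonneg x
    positivity
  · obtain ⟨c, hc⟩ : ∃ c, Nat.clog b x = c + 1 := ⟨Nat.clog b x - 1, by omega⟩
    have hlt : b ^ c < x := (Nat.lt_clog_iff_pow_lt hb).1 (by omega)
    have h1 : (c : ℝ) * Real.log b ≤ Real.log x := by
      rw [← Real.log_pow]
      exact Real.log_le_log (by positivity) (by exact_mod_cast hlt.le)
    rw [hc, Nat.cast_succ]
    gcongr
    rwa [le_div_iff₀ hlog]

/-- There is a constant `C > 0` such that for every alphabet of size
`σ ≥ 2`, every `ℓ ≥ 1` and every `n > ℓ`, the expected number of order-`ℓ` bd-anchors of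
a uniformly random string of `Σ^n` is at most `C·(n·log ℓ/(ℓ·log σ) + n/ℓ)`. -/
theorem expected_bdAnchors_bound :
    ∃ C : ℝ, 0 < C ∧
      ∀ (β : Type) (_ : LinearOrder β) (_ : Fintype β) (σ ℓ n : ℕ),
        Fintype.card β = σ → 2 ≤ σ → 1 ≤ ℓ → ℓ < n →
        (∑ T : Fin n → β, ((bdAnchors ℓ (List.ofFn T)).ncard : ℝ)) / (σ : ℝ) ^ n ≤
          C * ((n : ℝ) * Real.log ℓ / ((ℓ : ℝ) * Real.log σ) + (n : ℝ) / (ℓ : ℝ)) := by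
  refine ⟨24, by norm_num, ?_⟩
  intro β _ _ σ ℓ n hσ hσ2 hℓ hn
  have hpow : ℓ ≤ σ ^ (Nat.clog σ ℓ + 1) :=
    (Nat.le_pow_clog hσ2 ℓ).trans (Nat.pow_le_pow_right (by omega) (Nat.le_succ _))
  have h := mul_sum_ncard_bdAnchors_le (α := β) (k := Nat.clog σ ℓ + 1) (by omega)
    (by rwa [hσ]) hn
  rw [hσ] at h
  have hR : (ℓ : ℝ) * ∑ T : Fin n → β, ((bdAnchors ℓ (List.ofFn T)).ncard : ℝ) ≤
      12 * (Nat.clog σ ℓ + 1) * n * (σ : ℝ) ^ n := by exact_mod_cast h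
  have hclog := Nat.clog_le_log_div_log_add_one (x := ℓ) hσ2
  have hℓ0 : (0 : ℝ) < ℓ := by exact_mod_cast hℓ
  have hσ0 : (0 : ℝ) < σ := by positivity
  have hquot : 0 ≤ Real.log ℓ / Real.log σ :=
    div_nonneg (Real.log_natCast_nonneg ℓ) (Real.log_natCast_nonneg σ)
  rw [div_le_iff₀ (by positivity), ← mul_le_mul_iff_right₀ hℓ0]
  refine hR.trans ?_
  have hrhs : (ℓ : ℝ) * (24 * (n * Real.log ℓ / (ℓ * Real.log σ) + n / ℓ) * (σ : ℝ) ^ n) =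
      24 * (Real.log ℓ / Real.log σ + 1) * n * (σ : ℝ) ^ n := by
    have : Real.log σ ≠ 0 := (Real.log_pos (by exact_mod_cast hσ2)).ne'
    field_simp
  rw [hrhs]
  gcongr ?_ * _ * _
  linarith
end

section
/- There exists a constant C > 0 such that the following holds. For every finite linearly ordered alphabet Σ of size σ ≥ 2 and every integer ℓ ≥ 1 such that r := ⌈4·log ℓ/log σ⌉ satisfies 0 ≤ r ≤ ℓ−1, and every integer n > ℓ, if T is a string drawn uniformly at random from Σ^n (i.e., generated by a memoryless source with identical letter probabilities), then the expected size of the order-ℓ reduced bd-anchor set with parameter r satisfies E[|A_ℓ^red(T)|] ≤ C·n/ℓ. -/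
open scoped Classical

variable {α : Type*} [LinearOrder α]

/-- `j ∈ [1,ℓ-r]` is a position whose rotation is lexicographically minimal among the
rotations of `X` starting in `[1,ℓ-r]`. -/
def IsMinRotPosRed (X : List α) (r j : ℕ) : Prop :=
  j ∈ Finset.Icc 1 (X.length - r) ∧
    ∀ k ∈ Finset.Icc 1 (X.length - r), rot X j ≤ rot X k

/-- `j` is the reduced bd-anchor (with parameter `r`) of `X`. -/
def IsRedBdAnchor (X : List α) (r j : ℕ) : Prop :=
  IsMinRotPosRed X r j ∧ ∀ k, IsMinRotPosRed X r k → j ≤ k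

/-- The set `A_ℓ^red(T)` of order-`ℓ` reduced bd-anchors of `T` with parameter `r`. -/
def redBdAnchors (ℓ r : ℕ) (T : List α) : Set ℕ :=
  { p | ∃ i ∈ Finset.Icc 1 (T.length - ℓ + 1), ∃ j,
      IsRedBdAnchor (frag T i ℓ) r j ∧ p = i - 1 + j }


section UniformProbability

variable {ι β : Type*} [Fintype ι] [Fintype β]

/-- The probability of an event under the uniform distribution on `ι → β`. -/
noncomputable def unifProb (A : (ι → β) → Prop) : ℝ :=
  ((Finset.univ.filter A).card : ℝ) / Fintype.card (ι → β)

lemma unifProb_eq (A : (ι → β) → Prop) [DecidablePred A] :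
    unifProb A = ((Finset.univ.filter A).card : ℝ) / Fintype.card (ι → β) := by
  unfold unifProb
  congr!

lemma unifProb_nonneg (A : (ι → β) → Prop) : 0 ≤ unifProb A := by
  unfold unifProb; positivity

lemma unifProb_mono {A B : (ι → β) → Prop} (h : ∀ f, A f → B f) : unifProb A ≤ unifProb B := by
  unfold unifProb
  gcongr
  exact h _

lemma unifProb_le_one (A : (ι → β) → Prop) : unifProb A ≤ 1 := by
  unfold unifProb
  refine div_le_one_of_le₀ ?_ (by positivity)
  exact_mod_cast Finset.card_le_univ _

lemma unifProb_or_le (A B : (ι → β) → Prop) :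
    unifProb (fun f => A f ∨ B f) ≤ unifProb A + unifProb B := by
  simp only [unifProb_eq]
  rw [← add_div]
  gcongr
  rw [Finset.filter_or]
  exact_mod_cast Finset.card_union_le _ _

lemma unifProb_and_not (A B : (ι → β) → Prop) :
    unifProb (fun f => A f ∧ ¬ B f) = unifProb A - unifProb (fun f => A f ∧ B f) := by
  simp only [unifProb_eq]
  rw [← sub_div, ← Finset.filter_filter, ← Finset.filter_filter,
    ← Finset.card_filter_add_card_filter_not (s := Finset.univ.filter A) B]
  push_cast
  ring

/-- Events determined by disjoint sets of coordinates are independent. -/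
lemma unifProb_and_of_dependsOn [Nonempty β] {A B : (ι → β) → Prop} {S S' : Set ι}
    (hA : DependsOn A S) (hB : DependsOn B S') (hS : Disjoint S S') :
    unifProb (fun f => A f ∧ B f) = unifProb A * unifProb B := by
  have hcard : (Finset.univ.filter fun f => A f ∧ B f).card * Fintype.card (ι → β) =
      (Finset.univ.filter A).card * (Finset.univ.filter B).card := by
    rw [← Finset.card_univ, ← Finset.card_product, ← Finset.card_product]
    have key : ∀ f g : ι → β, A (S.piecewise f g) = A f ∧ B (S.piecewise f g) = B g := by
      refine fun f g => ⟨hA fun i hi => by simp [hi], hB fun i hi => ?_⟩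
      have : i ∉ S := fun h => Set.disjoint_left.1 hS h hi
      simp [this]
    have inv : ∀ f g : ι → β,
        S.piecewise (S.piecewise f g) (S.piecewise g f) = f := by
      intro f g
      ext i
      by_cases hi : i ∈ S <;> simp [hi]
    refine Finset.card_nbij' (fun x => (S.piecewise x.1 x.2, S.piecewise x.2 x.1))
      (fun x => (S.piecewise x.1 x.2, S.piecewise x.2 x.1)) ?_ ?_ ?_ ?_
    · rintro ⟨f, g⟩ h
      simpa [key] using h
    · rintro ⟨f, g⟩ h
      simpa [key] using h
    · rintro ⟨f, g⟩ -
      simp [inv]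
    · rintro ⟨f, g⟩ -
      simp [inv]
  simp only [unifProb_eq]
  have : (Fintype.card (ι → β) : ℝ) ≠ 0 := by exact_mod_cast Fintype.card_ne_zero
  field_simp
  exact_mod_cast hcard

lemma unifProb_forall_mem [Nonempty β] (S : Finset ι) (W : ι → Finset β) :
    unifProb (fun f : ι → β => ∀ i ∈ S, f i ∈ W i) =
      ∏ i ∈ S, ((W i).card / Fintype.card β : ℝ) := by
  have hset : (Finset.univ.filter fun f : ι → β => ∀ i ∈ S, f i ∈ W i) =
      Fintype.piFinset fun i => if i ∈ S then W i else Finset.univ := by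
    ext f
    simp only [Finset.mem_filter, Finset.mem_univ, true_and, Fintype.mem_piFinset]
    refine forall_congr' fun i => ?_
    by_cases hi : i ∈ S <;> simp [hi]
  have hβ : (Fintype.card β : ℝ) ≠ 0 := by exact_mod_cast Fintype.card_ne_zero
  rw [unifProb_eq, hset, Fintype.card_piFinset, Fintype.card_pi]
  push_cast
  rw [← Finset.prod_div_distrib, ← Finset.prod_subset (Finset.subset_univ S)]
  · exact Finset.prod_congr rfl fun i hi => by simp [hi]
  · intro i _ hi
    simp [hi, hβ]

end UniformProbability

lemma unifProb_exists_le {ι β κ : Type*} [Fintype ι] [Fintype β] [Fintype κ]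
    (A : κ → (ι → β) → Prop) :
    unifProb (fun f => ∃ k, A k f) ≤ ∑ k, unifProb (A k) := by
  simp only [unifProb_eq]
  rw [← Finset.sum_div]
  gcongr
  have : (Finset.univ.filter fun f => ∃ k, A k f) =
      Finset.univ.biUnion fun k => Finset.univ.filter (A k) := by
    ext f; simp
  rw [this]
  exact_mod_cast Finset.card_biUnion_le

section Blocks

/-- The coordinates in the interval `[x, y)`. -/
def coordIco (n x y : ℕ) : Set (Fin n) := {i | x ≤ (i : ℕ) ∧ (i : ℕ) < y}

lemma disjoint_coordIco {n x y x' y' : ℕ} (h : y ≤ x' ∨ y' ≤ x) :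
    Disjoint (coordIco n x y) (coordIco n x' y') := by
  rw [Set.disjoint_left]
  rintro i ⟨h1, h2⟩ ⟨h3, h4⟩
  omega

variable {n : ℕ} [NeZero n] {β : Type*}

/-- The letter of `T` at the 0-based position `i`, taken modulo the length of `T`. -/
def letterAt (T : Fin n → β) (i : ℕ) : β := T (Fin.ofNat n i)

lemma letterAt_congr {T T' : Fin n → β} {x y i : ℕ} (h : ∀ j ∈ coordIco n x y, T j = T' j)
    (hx : x ≤ i) (hy : i < y) (hn : y ≤ n) : letterAt T i = letterAt T' i := by
  apply h
  have : i % n = i := Nat.mod_eq_of_lt (by omega)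
  simp [coordIco, this, hx, hy]

lemma unifProb_block [Fintype β] [Nonempty β] {x d : ℕ} (h : x + d ≤ n) (W : ℕ → Finset β) :
    unifProb (fun T : Fin n → β => ∀ t < d, letterAt T (x + t) ∈ W t) =
      ∏ t ∈ Finset.range d, ((W t).card / Fintype.card β : ℝ) := by
  have hmod : ∀ t < d, (x + t) % n = x + t := fun t ht => Nat.mod_eq_of_lt (by omega)
  have hinj : Set.InjOn (fun t => Fin.ofNat n (x + t)) (Finset.range d) := by
    intro s hs t ht hst
    simp only [Finset.coe_range, Set.mem_Iio] at hs ht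
    have := congrArg Fin.val hst
    simp only [Fin.val_ofNat, hmod s hs, hmod t ht] at this
    omega
  have key := unifProb_forall_mem ((Finset.range d).image fun t => Fin.ofNat n (x + t))
    (fun i : Fin n => W (i - x))
  rw [Finset.prod_image hinj] at key
  have hW : ∀ t < d, W ((Fin.ofNat n (x + t) : Fin n) - x) = W t := by
    intro t ht
    rw [Fin.val_ofNat, hmod t ht, Nat.add_sub_cancel_left]
  rw [Finset.prod_congr rfl fun t ht => by rw [hW t (Finset.mem_range.1 ht)]] at key
  rw [← key]
  congr 1
  ext T
  simp only [Finset.mem_image, Finset.mem_range, forall_exists_index, and_imp,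
    forall_apply_eq_imp_iff₂, letterAt]
  exact forall₂_congr fun t ht => by rw [hW t ht]

lemma letterAt_of_lt (T : Fin n → β) {i : ℕ} (h : i < n) : letterAt T i = T ⟨i, h⟩ :=
  congrArg T (Fin.ext (Nat.mod_eq_of_lt h))

/-- The word `b a^d c` with `b ∉ C` and `c ∈ C` occurs in `T` at the 0-based position `s`. -/
def OccursAt (C : Finset β) (a : β) (d : ℕ) (T : Fin n → β) (s : ℕ) : Prop :=
  letterAt T s ∉ C ∧ (∀ t < d, letterAt T (s + 1 + t) = a) ∧ letterAt T (s + 1 + d) ∈ C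

/-- No word `b a^d c` with `b ∉ C` and `c ∈ C` occurs in `T[x..x+k)`. -/
def Avoids (C : Finset β) (a : β) (d x k : ℕ) (T : Fin n → β) : Prop :=
  ∀ s, x ≤ s → s + d + 1 < x + k → ¬ OccursAt C a d T s

lemma OccursAt.congr {C : Finset β} {a : β} {d s x y : ℕ} {T T' : Fin n → β}
    (hT : ∀ j ∈ coordIco n x y, T j = T' j) (hx : x ≤ s) (hy : s + d + 2 ≤ y) (hn : y ≤ n) :
    OccursAt C a d T s ↔ OccursAt C a d T' s := by
  unfold OccursAt
  rw [letterAt_congr hT hx (by omega) hn, letterAt_congr (i := s + 1 + d) hT (by omega) (by omega) hn]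
  refine and_congr_right fun _ => and_congr_left fun _ => forall₂_congr fun t ht => ?_
  rw [letterAt_congr (i := s + 1 + t) hT (by omega) (by omega) hn]

lemma dependsOn_avoids (C : Finset β) (a : β) (d : ℕ) {x k : ℕ} (h : x + k ≤ n) :
    DependsOn (Avoids (n := n) C a d x k) (coordIco n x (x + k)) := by
  intro T T' hT
  refine propext (forall_congr' fun s => forall₂_congr fun hx hk => not_congr ?_)
  exact OccursAt.congr hT hx (by omega) h

lemma unifProb_occursAt [Fintype β] (C : Finset β) (a : β) {d s : ℕ}
    (h : s + d + 2 ≤ n) :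
    unifProb (fun T : Fin n → β => OccursAt C a d T s) =
      (Fintype.card β - C.card) * C.card / (Fintype.card β : ℝ) ^ (d + 2) := by
  have : Nonempty β := ⟨a⟩
  have hβ : (Fintype.card β : ℝ) ≠ 0 := by exact_mod_cast Fintype.card_ne_zero
  have key := unifProb_block (n := n) (x := s) (d := d + 2) (by omega)
    (fun t => if t = 0 then Cᶜ else if t = d + 1 then C else {a})
  have hev : (fun T : Fin n → β => OccursAt C a d T s) = fun T => ∀ t < d + 2, letterAt T (s + t) ∈
      (if t = 0 then Cᶜ else if t = d + 1 then C else {a} : Finset β) := by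
    ext T
    constructor
    · rintro ⟨h1, h2, h3⟩ t ht
      rcases t with _ | t
      · simpa using h1
      · by_cases htd : t = d
        · subst htd
          simpa [add_assoc, add_comm 1] using h3
        · simpa [htd, add_assoc, add_comm 1] using h2 t (by omega)
    · intro H
      refine ⟨by simpa using H 0 (by omega), fun t ht => ?_, ?_⟩
      · simpa [ht.ne, add_assoc, add_comm 1] using H (t + 1) (by omega)
      · simpa [add_assoc, add_comm 1] using H (d + 1) (by omega)
  rw [hev, key, Finset.prod_range_succ, Finset.prod_range_succ']
  rw [Finset.prod_congr rfl (g := fun _ => (1 / Fintype.card β : ℝ)) fun t ht => by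
    simp [(Finset.mem_range.1 ht).ne]]
  simp only [Finset.prod_const, Finset.card_range, if_true, Nat.succ_ne_zero, if_false,
    Finset.card_compl]
  rw [Nat.cast_sub (Finset.card_le_univ C), div_pow, one_pow]
  field_simp
  ring

lemma unifProb_avoids_le [Fintype β] {C : Finset β} {a : β} (ha : a ∈ C) {d x : ℕ} (k : ℕ)
    (h : x + k ≤ n) :
    unifProb (Avoids (n := n) C a d x k) ≤
      (1 - (Fintype.card β - C.card) * C.card / (Fintype.card β : ℝ) ^ (d + 2)) ^ (k - d - 1) := by
  have : Nonempty β := ⟨a⟩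
  set q : ℝ := (Fintype.card β - C.card) * C.card / (Fintype.card β : ℝ) ^ (d + 2) with hq
  induction k with
  | zero => simpa using unifProb_le_one _
  | succ k ih =>
    rcases Nat.lt_or_ge k (d + 1) with hk | hk
    · rw [show k + 1 - d - 1 = 0 by omega]
      simpa using unifProb_le_one _
    specialize ih (by omega)
    obtain ⟨j, rfl⟩ : ∃ j, k = j + (d + 1) := ⟨k - (d + 1), by omega⟩
    have hqs : unifProb (fun T : Fin n → β => OccursAt C a d T (x + j)) = q :=
      unifProb_occursAt C a (by omega)
    have hq1 : q ≤ 1 := hqs ▸ unifProb_le_one _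
    have hq0 : 0 ≤ q := hqs ▸ unifProb_nonneg _
    have hstep : unifProb (Avoids (n := n) C a d x (j + (d + 1) + 1)) ≤
        unifProb (Avoids (n := n) C a d x (j + (d + 1))) -
          unifProb (fun T : Fin n → β => Avoids C a d x (j + (d + 1)) T ∧
            OccursAt C a d T (x + j)) := by
      rw [← unifProb_and_not]
      refine unifProb_mono fun T hT => ⟨fun s h1 h2 => hT s h1 (by omega), hT _ (by omega) (by omega)⟩
    have hind : unifProb (Avoids (n := n) C a d x (j + (d + 1))) * q ≤
        unifProb (fun T : Fin n → β => Avoids C a d x (j + (d + 1)) T ∧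
            OccursAt C a d T (x + j)) := by
      calc _ ≤ unifProb (Avoids (n := n) C a d x j) * q := by
            gcongr
            exact unifProb_mono fun T hT s h1 h2 => hT s h1 (by omega)
        _ = unifProb (fun T : Fin n → β => Avoids C a d x j T ∧ OccursAt C a d T (x + j)) := by
            rw [← hqs]
            refine (unifProb_and_of_dependsOn (S' := coordIco n (x + j) (x + j + d + 2))
              (dependsOn_avoids C a d (by omega))
              (fun T T' hT => propext (OccursAt.congr hT le_rfl le_rfl (by omega)))
              (disjoint_coordIco (Or.inl le_rfl))).symm
        _ ≤ _ := by
            refine unifProb_mono fun T hT => ⟨fun s h1 h2 hs => ?_, hT.2⟩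
            rcases Nat.lt_or_ge (s + d + 1) (x + j) with hlt | hge
            · exact hT.1 s h1 hlt hs
            obtain ⟨t, ht⟩ : ∃ t, x + j = s + 1 + t := ⟨x + j - s - 1, by omega⟩
            apply hT.2.1
            rw [ht]
            rcases (show t ≤ d by omega).eq_or_lt with rfl | htd
            · exact hs.2.2
            · rw [hs.2.1 t htd]
              exact ha
    rw [show j + (d + 1) + 1 - d - 1 = j + (d + 1) - d - 1 + 1 by omega, pow_succ]
    calc _ ≤ unifProb (Avoids (n := n) C a d x (j + (d + 1))) * (1 - q) := by linarith
      _ ≤ _ := by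
        gcongr

end Blocks

lemma sum_one_sub_mul_pow_le {N k : ℕ} (hN : 0 < N) (hk : 0 < k) :
    ∑ Z ∈ Finset.range N, (1 - (Z : ℝ) / (8 * N)) ^ k ≤ 1 + 8 * N / k := by
  have hN' : (1 : ℝ) ≤ N := by exact_mod_cast hN
  have hk' : (0 : ℝ) < k := by exact_mod_cast hk
  set u : ℝ := 1 / (8 * N) with hu
  have hu0 : 0 < u := by positivity
  have hu1 : u < 1 := by
    rw [hu, div_lt_one (by positivity)]; linarith
  have hbern : 1 + k * u ≤ (1 + u) ^ k := one_add_mul_le_pow (by linarith) k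
  set y : ℝ := (1 - u) ^ k with hy
  have hy0 : 0 ≤ y := pow_nonneg (by linarith) k
  have hyle : y * (1 + k * u) ≤ 1 := by
    calc y * (1 + k * u) ≤ y * (1 + u) ^ k := by gcongr
      _ = (1 - u ^ 2) ^ k := by rw [hy, ← mul_pow]; ring
      _ ≤ 1 := pow_le_one₀ (by nlinarith) (by nlinarith)
  have hku : 0 < k * u := by positivity
  have hy1 : y < 1 := by nlinarith
  calc ∑ Z ∈ Finset.range N, (1 - (Z : ℝ) / (8 * N)) ^ k
      ≤ ∑ Z ∈ Finset.range N, y ^ Z := by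
        refine Finset.sum_le_sum fun Z hZ => ?_
        have hZN : (Z : ℝ) ≤ N := by exact_mod_cast (Finset.mem_range.1 hZ).le
        have h0 : 0 ≤ 1 - (Z : ℝ) / (8 * N) := by
          rw [sub_nonneg, div_le_one (by positivity)]; linarith
        have h1 := one_add_mul_le_pow (a := -u) (by linarith) Z
        rw [hy, pow_right_comm]
        refine pow_le_pow_left₀ h0 ?_ k
        calc 1 - (Z : ℝ) / (8 * N) = 1 + Z * -u := by rw [hu]; ring
          _ ≤ (1 + -u) ^ Z := h1
          _ = _ := by ring
    _ ≤ (1 - y)⁻¹ := by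
        rw [← tsum_geometric_of_lt_one hy0 hy1]
        exact (summable_geometric_of_lt_one hy0 hy1).sum_le_tsum _ fun _ _ => pow_nonneg hy0 _
    _ ≤ 1 + 1 / (k * u) := by
        rw [inv_le_iff_one_le_mul₀ (by linarith)]
        have : (1 + 1 / (k * u)) * (1 - y) = 1 + (1 - y * (1 + k * u)) / (k * u) := by
          field_simp
          ring
        rw [this]
        have : 0 ≤ (1 - y * (1 + k * u)) / (k * u) := div_nonneg (by linarith) hku.le
        linarith
    _ = 1 + 8 * N / k := by rw [hu]; field_simp

lemma sum_mul_pow_lt_pow {σ : ℕ} (D : ℕ → ℕ) (hD : ∀ i, D i < σ) (m : ℕ) :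
    ∑ i ∈ Finset.range m, D i * σ ^ i < σ ^ m := by
  induction m with
  | zero => simp
  | succ m ih =>
    rw [Finset.sum_range_succ, pow_succ]
    calc _ < σ ^ m + D m * σ ^ m := by omega
      _ = (D m + 1) * σ ^ m := by ring
      _ ≤ σ * σ ^ m := by gcongr; exact hD m
      _ = _ := mul_comm _ _

section Words

variable {n : ℕ} [NeZero n] {β : Type*} [LinearOrder β]

/-- The word formed by the letters `z 0, ..., z (r - 1)`, read as a number in base `σ`
through the order isomorphism `e` of the alphabet with `Fin σ`. -/
def wordValue {σ : ℕ} (e : β ≃o Fin σ) (r : ℕ) (z : ℕ → β) : ℕ :=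
  ∑ i ∈ Finset.range r, (e (z (r - 1 - i)) : ℕ) * σ ^ i

lemma wordValue_lt {σ : ℕ} (e : β ≃o Fin σ) {r d : ℕ} (hd : d < r) (z : ℕ → β)
    (h0 : ∀ t < d, (e (z t) : ℕ) = 0) :
    wordValue e r z < ((e (z d) : ℕ) + 1) * σ ^ (r - 1 - d) := by
  obtain ⟨m, rfl⟩ : ∃ m, r = m + 1 + d := ⟨r - 1 - d, by omega⟩
  unfold wordValue
  rw [Finset.sum_range_add, Finset.sum_range_succ]
  have hz : ∑ i ∈ Finset.range d, (e (z (m + 1 + d - 1 - (m + 1 + i))) : ℕ) * σ ^ (m + 1 + i) = 0 := by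
    refine Finset.sum_eq_zero fun i hi => ?_
    have := Finset.mem_range.1 hi
    rw [h0 _ (by omega), zero_mul]
  have hlt := sum_mul_pow_lt_pow (fun i => (e (z (m + 1 + d - 1 - i)) : ℕ)) (fun i => (e _).2) m
  rw [hz, show m + 1 + d - 1 - m = d by omega, show m + 1 + d - 1 - d = m by omega, add_mul]
  omega

/-- The word `T[q..q+r)` is not lexicographically smaller than `z 0, ..., z (r - 1)`. -/
def BlockGe (T : Fin n → β) (z : ℕ → β) (r q : ℕ) : Prop :=
  ∀ d < r, (∀ t < d, letterAt T (q + t) = z t) → z d ≤ letterAt T (q + d)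

lemma exists_event_of_blockGe [Fintype β] {σ : ℕ} (hσ : 2 ≤ σ) (e : β ≃o Fin σ) (r : ℕ) (z : ℕ → β)
    {x K : ℕ} (h : x + K ≤ n) :
    ∃ V : (Fin n → β) → Prop, DependsOn V (coordIco n x (x + K)) ∧
      unifProb V ≤ (1 - (wordValue e r z : ℝ) / (8 * (σ ^ r : ℕ))) ^ (K - r) ∧
      ∀ T, (∀ q, x < q → q < x + K → BlockGe T z r q) → V T := by
  have hcard : Fintype.card β = σ := by simpa using Fintype.card_congr e.toEquiv
  by_cases hz : ∀ t < r, (e (z t) : ℕ) = 0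
  · refine ⟨fun _ => True, fun _ _ _ => rfl, ?_, fun _ _ => trivial⟩
    have : wordValue e r z = 0 := by
      refine Finset.sum_eq_zero fun i hi => ?_
      have := Finset.mem_range.1 hi
      rw [hz _ (by omega), zero_mul]
    rw [this]
    simpa using unifProb_le_one _
  push Not at hz
  classical
  set d := Nat.find hz with hd
  obtain ⟨hdr, hc⟩ : d < r ∧ (e (z d) : ℕ) ≠ 0 := Nat.find_spec hz
  have h0 : ∀ t < d, (e (z t) : ℕ) = 0 := by
    intro t ht
    by_contra hne
    exact Nat.find_min hz ht ⟨by omega, hne⟩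
  set c : ℕ := (e (z d)).val with hcdef
  have hcσ : c < σ := (e (z d)).2
  set c₀ := min c (σ / 2) with hc₀
  set a : β := e.symm ⟨0, by omega⟩ with hadef
  set C : Finset β := Finset.univ.filter fun b => (e b : ℕ) < c₀ with hCdef
  have haC : a ∈ C := by
    simp only [hCdef, Finset.mem_filter, Finset.mem_univ, true_and, hadef, OrderIso.apply_symm_apply]
    omega
  have hCcard : C.card = c₀ := by
    have : C = (Finset.univ.filter fun i : Fin σ => (i : ℕ) < c₀).map e.symm.toEquiv.toEmbedding := by
      ext b
      simp [hCdef, Finset.mem_map_equiv]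
    rw [this, Finset.card_map, Fin.card_filter_val_lt]
    omega
  refine ⟨Avoids C a d x K, dependsOn_avoids C a d h, ?_, ?_⟩
  · refine (unifProb_avoids_le haC K h).trans ?_
    rw [hCcard, hcard]
    have hv := wordValue_lt e hdr z h0
    generalize wordValue e r z = v at hv ⊢
    have hvle : (v : ℝ) / (8 * (σ ^ r : ℕ)) ≤ (σ - c₀) * c₀ / (σ : ℝ) ^ (d + 2) := by
      obtain ⟨m, hm⟩ : ∃ m, r = d + 1 + m := ⟨r - 1 - d, by omega⟩
      have hσ0 : (0 : ℝ) < σ := by exact_mod_cast (by omega : 0 < σ)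
      have hv' : (v : ℝ) ≤ 2 * c * (σ : ℝ) ^ m := by
        have : v ≤ 2 * c * σ ^ m := by
          refine hv.le.trans ?_
          rw [show r - 1 - d = m by omega]
          gcongr
          omega
        exact_mod_cast this
      have h1 : (c : ℝ) ≤ 2 * c₀ := by
        exact_mod_cast (by omega : c ≤ 2 * c₀)
      have h2 : (σ : ℝ) ≤ 2 * (σ - c₀) := by
        have : (2 * c₀ : ℝ) ≤ σ := by exact_mod_cast (by omega : 2 * c₀ ≤ σ)
        linarith
      rw [div_le_div_iff₀ (by positivity) (by positivity)]
      push_cast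
      have h3 : (c : ℝ) * σ ≤ (2 * c₀) * (2 * (σ - c₀)) := by gcongr
      calc (v : ℝ) * σ ^ (d + 2) ≤ 2 * c * (σ : ℝ) ^ m * σ ^ (d + 2) := by gcongr
        _ = 2 * σ ^ (d + 1 + m) * (c * σ) := by ring
        _ ≤ 2 * σ ^ (d + 1 + m) * ((2 * c₀) * (2 * (σ - c₀))) := by gcongr
        _ = _ := by rw [hm]; ring
    have hq1 : (σ - c₀) * c₀ / (σ : ℝ) ^ (d + 2) ≤ 1 := by
      have hc₀σ : (c₀ : ℝ) ≤ σ := by exact_mod_cast (by omega : c₀ ≤ σ)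
      have hσ1 : (1 : ℝ) ≤ σ := by exact_mod_cast (by omega : 1 ≤ σ)
      rw [div_le_one (by positivity)]
      calc (σ - c₀ : ℝ) * c₀ ≤ σ * σ := by
            gcongr
            have : (0 : ℝ) ≤ c₀ := by positivity
            linarith
        _ = σ ^ 2 := by ring
        _ ≤ _ := by gcongr; omega
    have hv0 : (0 : ℝ) ≤ (v : ℝ) / (8 * (σ ^ r : ℕ)) := by positivity
    calc _ ≤ (1 - (v : ℝ) / (8 * (σ ^ r : ℕ))) ^ (K - d - 1) := by
          refine pow_le_pow_left₀ (by linarith) (by linarith) _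
      _ ≤ _ := pow_le_pow_of_le_one (by linarith) (by linarith) (by omega)
  · intro T hT s hs hsK hocc
    have hle := hT (s + 1) (by omega) (by omega) d hdr fun t ht => by
      rw [hocc.2.1 t ht, hadef, OrderIso.symm_apply_eq]
      exact Fin.ext (h0 t ht).symm
    have hlt := hocc.2.2
    simp only [hCdef, Finset.mem_filter, Finset.mem_univ, true_and] at hlt
    have : c ≤ (e (letterAt T (s + 1 + d)) : ℕ) := e.monotone hle
    omega

/-- Summing over words of length `r` a function of their value. -/
lemma sum_wordValue [Fintype β] {σ r : ℕ} [NeZero r] (e : β ≃o Fin σ) (g : ℕ → ℝ) :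
    ∑ z : Fin r → β, g (wordValue e r (letterAt z)) = ∑ Z ∈ Finset.range (σ ^ r), g Z := by
  rw [Finset.sum_range]
  refine Fintype.sum_equiv
    ((Equiv.arrowCongr Fin.revPerm e.toEquiv).trans finFunctionFinEquiv) _ _ fun z => ?_
  congr 1
  rw [Equiv.trans_apply, finFunctionFinEquiv_apply, wordValue, Finset.sum_range]
  refine Finset.sum_congr rfl fun i _ => ?_
  have hi : r - 1 - (i : ℕ) < r := by omega
  have : (⟨r - 1 - i, hi⟩ : Fin r) = i.rev := by
    ext
    simp only [Fin.val_rev]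
    omega
  rw [letterAt_of_lt z hi, this]
  simp

lemma unifProb_blockGe_le [Fintype β] {σ : ℕ} (hσ : 2 ≤ σ) (e : β ≃o Fin σ) {r p x K : ℕ}
    (hp : p + r ≤ n) (hx : x + K ≤ n) (hdisj : p + r ≤ x ∨ x + K ≤ p) (hrK : r < K) :
    unifProb (fun T : Fin n → β => ∀ q, x < q → q < x + K →
      BlockGe T (fun t => letterAt T (p + t)) r q) ≤ 1 / (σ : ℝ) ^ r + 8 / (K - r : ℕ) := by
  have hcard : Fintype.card β = σ := by simpa using Fintype.card_congr e.toEquiv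
  have : Nonempty β := ⟨e.symm ⟨0, by omega⟩⟩
  have hσ0 : (0 : ℝ) < σ := by exact_mod_cast (by omega : 0 < σ)
  rcases Nat.eq_zero_or_pos r with rfl | hr
  · refine (unifProb_le_one _).trans ?_
    rw [pow_zero, div_one]
    linarith [show (0 : ℝ) ≤ 8 / (K - 0 : ℕ) by positivity]
  have : NeZero r := ⟨hr.ne'⟩
  choose V hVdep hVprob hV using fun z : Fin r → β =>
    exists_event_of_blockGe (n := n) hσ e r (letterAt z) hx
  have hZ : ∀ z : Fin r → β, unifProb (fun T : Fin n → β =>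
      ∀ t < r, letterAt T (p + t) ∈ ({letterAt z t} : Finset β)) = 1 / (σ : ℝ) ^ r := by
    intro z
    rw [unifProb_block hp]
    simp [hcard]
  calc _ ≤ unifProb (fun T : Fin n → β => ∃ z : Fin r → β,
          (∀ t < r, letterAt T (p + t) ∈ ({letterAt z t} : Finset β)) ∧ V z T) := by
        refine unifProb_mono fun T hT => ⟨fun t => letterAt T (p + t), ?_, hV _ T ?_⟩
        · intro t ht
          simp [letterAt_of_lt _ ht]
        · intro q h1 h2 d hd hpre
          have hval : ∀ t < r, letterAt (n := r) (fun t => letterAt T (p + t)) t =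
              letterAt T (p + t) := fun t ht => by
            rw [letterAt_of_lt _ ht]
          rw [hval d hd]
          exact hT q h1 h2 d hd fun t ht => (hpre t ht).trans (hval t (by omega))
    _ ≤ ∑ z : Fin r → β, unifProb (fun T : Fin n → β =>
          (∀ t < r, letterAt T (p + t) ∈ ({letterAt z t} : Finset β)) ∧ V z T) :=
        unifProb_exists_le _
    _ ≤ ∑ z : Fin r → β, 1 / (σ : ℝ) ^ r *
          (1 - (wordValue e r (letterAt z) : ℝ) / (8 * (σ ^ r : ℕ))) ^ (K - r) := by
        refine Finset.sum_le_sum fun z _ => ?_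
        rw [unifProb_and_of_dependsOn (S := coordIco n p (p + r)) _ (hVdep z)
          (disjoint_coordIco hdisj), hZ]
        · gcongr
          exact hVprob z
        · intro T T' hT
          refine propext (forall₂_congr fun t ht => ?_)
          rw [letterAt_congr hT (by omega) (by omega) hp]
    _ = 1 / (σ : ℝ) ^ r * ∑ Z ∈ Finset.range (σ ^ r),
          (1 - (Z : ℝ) / (8 * (σ ^ r : ℕ))) ^ (K - r) := by
        rw [← Finset.mul_sum,
          sum_wordValue e fun Z => (1 - (Z : ℝ) / (8 * (σ ^ r : ℕ))) ^ (K - r)]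
    _ ≤ 1 / (σ : ℝ) ^ r * (1 + 8 * (σ ^ r : ℕ) / (K - r : ℕ)) := by
        gcongr
        exact sum_one_sub_mul_pow_le (pow_pos (by omega) r) (by omega)
    _ = _ := by
        have : ((K - r : ℕ) : ℝ) ≠ 0 := by exact_mod_cast (by omega : K - r ≠ 0)
        push_cast
        field_simp

end Words

section Anchors

lemma length_rot {β : Type*} (W : List β) (j : ℕ) : (rot W j).length = W.length := by
  simp only [rot, List.length_append, List.length_drop, List.length_take]
  omega

lemma length_frag_ofFn {β : Type*} {n : ℕ} {T : Fin n → β} {i ℓ : ℕ} (h : i - 1 + ℓ ≤ n) :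
    (frag (List.ofFn T) i ℓ).length = ℓ := by
  simp only [frag, List.length_take, List.length_drop, List.length_ofFn]
  omega

variable {n : ℕ} [NeZero n] {β : Type*} [LinearOrder β]

lemma getElem_rot_frag_ofFn {β : Type*} {T : Fin n → β} {i ℓ k t : ℕ} (h : i - 1 + ℓ ≤ n)
    (hk : k - 1 + t < ℓ) (ht : t < (rot (frag (List.ofFn T) i ℓ) k).length) :
    (rot (frag (List.ofFn T) i ℓ) k)[t] = letterAt T (i - 1 + (k - 1) + t) := by
  rw [letterAt_of_lt T (by omega)]
  have hlen : t < ((frag (List.ofFn T) i ℓ).drop (k - 1)).length := by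
    rw [List.length_drop, length_frag_ofFn h]
    omega
  simp only [rot]
  rw [List.getElem_append_left hlen]
  simp [frag, add_assoc]

lemma blockGe_of_isMinRotPosRed {T : Fin n → β} {i ℓ r j : ℕ} (h : i - 1 + ℓ ≤ n) (hr : r ≤ ℓ)
    (hj : IsMinRotPosRed (frag (List.ofFn T) i ℓ) r j) {k : ℕ} (hk : k < ℓ - r) :
    BlockGe T (fun t => letterAt T (i - 1 + (j - 1) + t)) r (i - 1 + k) := by
  obtain ⟨hmem, hmin⟩ := hj
  rw [length_frag_ofFn h, Finset.mem_Icc] at hmem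
  intro d hd hpre
  by_contra hlt
  rw [not_le] at hlt
  have hle := hmin (k + 1) (by rw [length_frag_ofFn h, Finset.mem_Icc]; omega)
  refine absurd ?_ (not_lt.2 hle)
  rw [List.lt_iff_exists]
  right
  have hlen : ∀ m, d < (rot (frag (List.ofFn T) i ℓ) m).length := fun m => by
    rw [length_rot, length_frag_ofFn h]
    omega
  refine ⟨d, hlen _, hlen _, fun t ht => ?_, ?_⟩
  · rw [getElem_rot_frag_ofFn h (by omega), getElem_rot_frag_ofFn h (by omega)]
    exact hpre t ht
  · rw [getElem_rot_frag_ofFn h (by omega), getElem_rot_frag_ofFn h (by omega)]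
    exact hlt

/-- The word `T[p..p+r)` is minimal among the words `T[q..q+r)` for `q` ranging over an interval
of about `h` positions to the right or to the left of `p`. -/
def IsOneSidedMin (r h p : ℕ) (T : Fin n → β) : Prop :=
  (p + h ≤ n ∧ ∀ q, p + r < q → q < p + r + (h - r) →
      BlockGe T (fun t => letterAt T (p + t)) r q) ∨
    (h ≤ p ∧ p + r ≤ n ∧ ∀ q, p - h < q → q < p - h + (h - r) →
      BlockGe T (fun t => letterAt T (p + t)) r q)

lemma unifProb_isOneSidedMin_le [Fintype β] {σ : ℕ} (hσ : 2 ≤ σ) (e : β ≃o Fin σ) {r h p : ℕ}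
    (hrh : 2 * r < h) :
    unifProb (IsOneSidedMin (n := n) (β := β) r h p) ≤
      2 * (1 / (σ : ℝ) ^ r + 8 / (h - r - r : ℕ)) := by
  have hnn : 0 ≤ 1 / (σ : ℝ) ^ r + 8 / (h - r - r : ℕ) := by positivity
  have hfalse : unifProb (fun _ : Fin n → β => False) = 0 := by
    rw [unifProb_eq]
    simp
  refine (unifProb_or_le _ _).trans ?_
  rw [two_mul]
  refine add_le_add ?_ ?_
  · by_cases hp : p + h ≤ n
    · simp only [hp, true_and]
      exact unifProb_blockGe_le hσ e (by omega) (by omega) (Or.inl le_rfl) (by omega)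
    · simpa only [hp, false_and, hfalse] using hnn
  · by_cases hp : h ≤ p ∧ p + r ≤ n
    · simp only [hp, true_and]
      exact unifProb_blockGe_le hσ e hp.2 (by omega) (Or.inr (by omega)) (by omega)
    · refine le_trans (unifProb_mono fun T hT => hp ⟨hT.1, hT.2.1⟩) (hfalse.trans_le hnn)

lemma redBdAnchors_ofFn_subset {T : Fin n → β} {ℓ r h : ℕ} (hn : ℓ ≤ n)
    (hh : 2 * h + 1 ≤ ℓ - r) (hrh : 2 * r < h) :
    redBdAnchors ℓ r (List.ofFn T) ⊆
      ((Finset.range n).filter fun p => IsOneSidedMin r h p T).image (· + 1) := by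
  rintro _ ⟨i, hi, j, ⟨hj, -⟩, rfl⟩
  rw [List.length_ofFn, Finset.mem_Icc] at hi
  have hi' : i - 1 + ℓ ≤ n := by omega
  have hmin := fun k (hk : k < ℓ - r) => blockGe_of_isMinRotPosRed hi' (by omega) hj hk
  have hmem := hj.1
  rw [length_frag_ofFn hi', Finset.mem_Icc] at hmem
  simp only [Finset.coe_image, Finset.coe_filter, Finset.mem_range, Set.mem_image,
    Set.mem_ofPred_eq]
  refine ⟨i - 1 + (j - 1), ⟨by omega, ?_⟩, by omega⟩
  rcases Nat.lt_or_ge (j - 1) h with hlt | hge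
  · refine Or.inl ⟨by omega, fun q h1 h2 => ?_⟩
    have := hmin (q - (i - 1)) (by omega)
    rwa [show i - 1 + (q - (i - 1)) = q by omega] at this
  · refine Or.inr ⟨by omega, by omega, fun q h1 h2 => ?_⟩
    have := hmin (q - (i - 1)) (by omega)
    rwa [show i - 1 + (q - (i - 1)) = q by omega] at this

lemma ncard_redBdAnchors_le {n : ℕ} {T : Fin n → β} {ℓ r : ℕ} (hn : ℓ ≤ n) :
    (redBdAnchors ℓ r (List.ofFn T)).ncard ≤ n := by
  have hsub : redBdAnchors ℓ r (List.ofFn T) ⊆ Finset.Icc 1 n := by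
    rintro _ ⟨i, hi, j, ⟨hj, -⟩, rfl⟩
    rw [List.length_ofFn, Finset.mem_Icc] at hi
    have hmem := hj.1
    rw [length_frag_ofFn (by omega), Finset.mem_Icc] at hmem
    rw [Finset.coe_Icc, Set.mem_Icc]
    omega
  simpa [Set.ncard_coe_finset] using Set.ncard_le_ncard hsub (Finset.finite_toSet _)

lemma sum_ncard_redBdAnchors_le [Fintype β] {σ : ℕ} (hσ : 2 ≤ σ) (e : β ≃o Fin σ) {ℓ r h : ℕ}
    (hn : ℓ ≤ n) (hh : 2 * h + 1 ≤ ℓ - r) (hrh : 2 * r < h) :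
    (∑ T : Fin n → β, ((redBdAnchors ℓ r (List.ofFn T)).ncard : ℝ)) / (σ : ℝ) ^ n ≤
      n * (2 * (1 / (σ : ℝ) ^ r + 8 / (h - r - r : ℕ))) := by
  have hcard : (Fintype.card (Fin n → β) : ℝ) = (σ : ℝ) ^ n := by
    rw [Fintype.card_fun, Fintype.card_congr e.toEquiv]
    simp
  calc _ ≤ (∑ T : Fin n → β, ∑ p ∈ Finset.range n,
          if IsOneSidedMin r h p T then (1 : ℝ) else 0) / (σ : ℝ) ^ n := by
        gcongr with T
        have hle := Set.ncard_le_ncard (redBdAnchors_ofFn_subset (T := T) hn hh hrh)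
          (Finset.finite_toSet _)
        rw [Set.ncard_coe_finset] at hle
        rw [Finset.sum_boole]
        exact_mod_cast hle.trans Finset.card_image_le
    _ = ∑ p ∈ Finset.range n, unifProb (IsOneSidedMin (n := n) (β := β) r h p) := by
        rw [Finset.sum_comm, Finset.sum_div]
        refine Finset.sum_congr rfl fun p _ => ?_
        rw [Finset.sum_boole, unifProb_eq, ← hcard]
        congr!
    _ ≤ ∑ p ∈ Finset.range n, 2 * (1 / (σ : ℝ) ^ r + 8 / (h - r - r : ℕ)) :=
        Finset.sum_le_sum fun p _ => unifProb_isOneSidedMin_le hσ e hrh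
    _ = _ := by simp

end Anchors

lemma exists_forall_log_le : ∃ L : ℕ, ∀ ℓ : ℕ, L ≤ ℓ → 4 * Real.log ℓ / Real.log 2 + 1 ≤ ℓ / 20 := by
  have hlog : (0 : ℝ) < Real.log 2 := Real.log_pos one_lt_two
  have h := (Real.isLittleO_log_id_atTop.comp_tendsto tendsto_natCast_atTop_atTop).bound
    (show 0 < Real.log 2 / 160 by positivity)
  obtain ⟨L, hL⟩ := Filter.eventually_atTop.1 h
  refine ⟨max L 40, fun ℓ hℓ => ?_⟩
  have h1 := hL ℓ (le_trans (le_max_left _ _) hℓ)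
  have h2 : (40 : ℝ) ≤ ℓ := by exact_mod_cast (le_trans (le_max_right _ _) hℓ)
  simp only [Function.comp_apply, id, Real.norm_eq_abs, Nat.abs_cast] at h1
  have h3 := (le_abs_self _).trans h1
  have h4 : 4 * Real.log ℓ / Real.log 2 ≤ ℓ / 40 := by
    rw [div_le_iff₀ hlog]
    linarith
  linarith

/-- There is a constant `C > 0` such that for every alphabet of size
`σ ≥ 2`, every `ℓ ≥ 1` such that `r = ⌈4·log ℓ/log σ⌉` satisfies `0 ≤ r ≤ ℓ-1`, and every
`n > ℓ`, the expected number of order-`ℓ` reduced bd-anchors (with parameter `r`) of a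
uniformly random string of `Σ^n` is at most `C·n/ℓ`. -/
theorem expected_redBdAnchors_bound :
    ∃ C : ℝ, 0 < C ∧
      ∀ (β : Type) (_ : LinearOrder β) (_ : Fintype β) (σ ℓ n r : ℕ),
        Fintype.card β = σ → 2 ≤ σ → 1 ≤ ℓ →
        (r : ℤ) = ⌈(4 * Real.log ℓ / Real.log σ : ℝ)⌉ → r ≤ ℓ - 1 → ℓ < n →
        (∑ T : Fin n → β, ((redBdAnchors ℓ r (List.ofFn T)).ncard : ℝ)) / (σ : ℝ) ^ n ≤
          C * (n : ℝ) / (ℓ : ℝ) := by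
  obtain ⟨L, hL⟩ := exists_forall_log_le
  refine ⟨max L 66, lt_of_lt_of_le (by norm_num) (le_max_right _ _), ?_⟩
  intro β _ _ σ ℓ n r hcard hσ hℓ hr hrℓ hn
  have : NeZero n := ⟨by omega⟩
  have e : β ≃o Fin σ := (Fintype.orderIsoFinOfCardEq β hcard).symm
  have hℓ0 : (0 : ℝ) < ℓ := by exact_mod_cast hℓ
  have hσ2 : (2 : ℝ) ≤ σ := by exact_mod_cast hσ
  have hσ0 : (0 : ℝ) < σ := by linarith
  have hlogσ : 0 < Real.log σ := Real.log_pos (by linarith)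
  have hlogℓ : 0 ≤ Real.log ℓ := Real.log_nonneg (by exact_mod_cast hℓ)
  rcases Nat.lt_or_ge ℓ (max L 40) with hsmall | hlarge
  · have hℓC : (ℓ : ℝ) ≤ max (L : ℝ) 66 := by
      rcases lt_max_iff.1 hsmall with h | h
      · exact le_max_of_le_left (by exact_mod_cast h.le)
      · exact le_max_of_le_right (by exact_mod_cast (by omega : ℓ ≤ 66))
    rw [div_le_iff₀ (by positivity)]
    calc ∑ T : Fin n → β, ((redBdAnchors ℓ r (List.ofFn T)).ncard : ℝ)
        ≤ ∑ T : Fin n → β, (n : ℝ) :=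
          Finset.sum_le_sum fun T _ => by exact_mod_cast ncard_redBdAnchors_le hn.le
      _ = n * (σ : ℝ) ^ n := by
          rw [Finset.sum_const, Finset.card_univ, Fintype.card_fun, hcard, nsmul_eq_mul]
          push_cast
          rw [Fintype.card_fin, mul_comm]
      _ ≤ _ := by
          gcongr
          rw [le_div_iff₀ hℓ0, mul_comm]
          gcongr
  · have hlogr := hL ℓ (le_trans (le_max_left _ _) hlarge)
    have hr_lt : (r : ℝ) < 4 * Real.log ℓ / Real.log σ + 1 := by
      have := Int.ceil_lt_add_one (4 * Real.log ℓ / Real.log σ : ℝ)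
      rw [← hr] at this
      exact_mod_cast this
    have hr_ge : 4 * Real.log ℓ / Real.log σ ≤ r := by
      have := Int.le_ceil (4 * Real.log ℓ / Real.log σ : ℝ)
      rw [← hr] at this
      exact_mod_cast this
    have hr20 : 20 * r ≤ ℓ := by
      have h1 : 4 * Real.log ℓ / Real.log σ ≤ 4 * Real.log ℓ / Real.log 2 := by
        gcongr
      have : (20 * r : ℝ) ≤ ℓ := by linarith
      exact_mod_cast this
    have h40 : 40 ≤ ℓ := le_trans (le_max_right _ _) hlarge
    have hN : (ℓ : ℝ) ≤ (σ : ℝ) ^ r := by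
      rw [← Real.log_le_log_iff hℓ0 (by positivity), Real.log_pow]
      rw [div_le_iff₀ hlogσ] at hr_ge
      linarith
    have hk : (ℓ : ℝ) / 4 ≤ ((ℓ - r - 1) / 2 - r - r : ℕ) := by
      rw [div_le_iff₀ (by norm_num)]
      exact_mod_cast (by omega : ℓ ≤ ((ℓ - r - 1) / 2 - r - r) * 4)
    refine (sum_ncard_redBdAnchors_le (h := (ℓ - r - 1) / 2) hσ e hn.le (by omega)
      (by omega)).trans ?_
    calc (n : ℝ) * (2 * (1 / (σ : ℝ) ^ r + 8 / ((ℓ - r - 1) / 2 - r - r : ℕ)))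
        ≤ n * (2 * (1 / ℓ + 8 / (ℓ / 4))) := by gcongr
      _ = 66 * n / ℓ := by field_simp; ring
      _ ≤ _ := by gcongr; exact le_max_right _ _
end
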